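/- Let G be a finite simple graph with n vertices that is 3-regular, connected, and has no bridge (i.e., G is 2-edge-connected and cubic). Then G admits a contact representation by triangles lying on an integer grid of size 3 × n/2 × n/2: there is an injective assignment e ↦ p_e of points of ℤ³ to the edges of G, with first coordinates among 3 fixed consecutive integers, second coordinates among n/2 fixed consecutive integers, and third coordinates among n/2 fixed consecutive integers, such that for every vertex v the three points {p_e : e incident to v} are affinely independent and, writing T_v for their convex hull, for distinct vertices u, v one has T_u ∩ T_v = {p_{uv}} if uv is an edge of G and T_u ∩ T_v = ∅ otherwise. -/

import Mathlib

/-- The horizontal first coordinate of the `j`-th rim point: the rim runs up the line `x = -1`,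
through one point with `x = 0`, and down the line `x = 1`. -/
def rimX (N j : ℕ) : ℤ := if j < N then -1 else if j = N then 0 else 1

/-- The horizontal second coordinate of the `j`-th rim point. -/
def rimY (N j : ℕ) : ℤ := if j < N then j else if j = N then N - 1 else 2 * N - j

/-- Twice the signed area spanned by the origin and two rim points. -/
def rimCross (N i j : ℕ) : ℤ := rimX N j * rimY N i - rimX N i * rimY N j

theorem rimCross_pos {N i j : ℕ} (hN : 2 ≤ N) (hij : i < j) (hj : j < 2 * N) :
    0 < rimCross N i j := by
  unfold rimCross rimX rimY
  split_ifs <;> omega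

theorem rimCross_self (N i : ℕ) : rimCross N i i = 0 := by
  unfold rimCross; ring

theorem rimCross_swap (N i j : ℕ) : rimCross N j i = -rimCross N i j := by
  unfold rimCross; ring

/-- The rim is convex: the rim points between two given ones lie behind their chord,
as seen from the origin. -/
theorem rimCross_le_add {N i j k : ℕ} (hij : i ≤ j) (hjk : j ≤ k) :
    rimCross N i k ≤ rimCross N i j + rimCross N j k := by
  unfold rimCross rimX rimY
  split_ifs <;> omega

/-- The `j`-th rim point, at height `z j`. -/
def rimPoint (N : ℕ) (z : ℕ → ℕ) (j : ℕ) : EuclideanSpace ℝ (Fin 3) :=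
  !₂[(rimX N j : ℝ), (rimY N j : ℝ), (z j : ℝ)]

/-- The point of the vertical axis at height `m`. -/
def axisPoint (m : ℕ) : EuclideanSpace ℝ (Fin 3) := !₂[0, 0, (m : ℝ)]

/-- The corners of a triangle with two rim points and one axis point. -/
def corners (N : ℕ) (z : ℕ → ℕ) (s t m : ℕ) : Set (EuclideanSpace ℝ (Fin 3)) :=
  {rimPoint N z s, rimPoint N z t, axisPoint m}

/-- A face of a convex hull cut out by a supporting hyperplane is spanned by the generators
lying on that hyperplane. -/
theorem mem_convexHull_inter_of_nonneg {E : Type*} [AddCommGroup E] [Module ℝ E]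
    {S : Set E} {ψ : E →ᵃ[ℝ] ℝ} (hS : ∀ x ∈ S, 0 ≤ ψ x) {x : E} (hx : x ∈ convexHull ℝ S)
    (h : ψ x ≤ 0) : x ∈ convexHull ℝ (S ∩ {y | ψ y = 0}) := by
  have h0 : ∀ y ∈ convexHull ℝ (S ∩ {y | ψ y = 0}), ψ y = 0 := fun y hy =>
    convexHull_min (t := {y | ψ y = 0}) Set.inter_subset_right
      ((convex_singleton (0 : ℝ)).affine_preimage ψ) hy
  have hconv : Convex ℝ ({y | 0 < ψ y} ∪ convexHull ℝ (S ∩ {y | ψ y = 0})) := by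
    intro a ha b hb α β hα hβ hαβ
    have key : ψ (α • a + β • b) = α * ψ a + β * ψ b := by
      simpa using Convex.combo_affine_apply (f := ψ) hαβ
    rcases hα.eq_or_lt with rfl | hα'
    · have : β = 1 := by linarith
      subst this; simpa using hb
    rcases hβ.eq_or_lt with rfl | hβ'
    · have : α = 1 := by linarith
      subst this; simpa using ha
    rcases ha with ha | ha <;> rcases hb with hb | hb
    · left; simp only [Set.mem_ofPred_eq] at *; rw [key]; positivity
    · left; simp only [Set.mem_ofPred_eq] at *; rw [key, h0 b hb]; simp; positivity
    · left; simp only [Set.mem_ofPred_eq] at *; rw [key, h0 a ha]; simp; positivity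
    · right; exact convex_convexHull ℝ _ ha hb hα hβ hαβ
  have hsub : S ⊆ {y | 0 < ψ y} ∪ convexHull ℝ (S ∩ {y | ψ y = 0}) := fun y hy => by
    rcases (hS y hy).eq_or_lt with h' | h'
    · exact Or.inr (subset_convexHull ℝ _ ⟨hy, h'.symm⟩)
    · exact Or.inl h'
  rcases convexHull_min hsub hconv hx with h' | h'
  · exact absurd h (not_le.mpr h')
  · exact h'

/-- The affine functional with given coefficients. -/
noncomputable def affineForm (a b c d : ℝ) : EuclideanSpace ℝ (Fin 3) →ᵃ[ℝ] ℝ :=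
  (a • (EuclideanSpace.proj 0 : EuclideanSpace ℝ (Fin 3) →L[ℝ] ℝ)
    + b • (EuclideanSpace.proj 1 : EuclideanSpace ℝ (Fin 3) →L[ℝ] ℝ)
    + c • (EuclideanSpace.proj 2 : EuclideanSpace ℝ (Fin 3) →L[ℝ] ℝ)).toLinearMap.toAffineMap
    + AffineMap.const ℝ _ d

theorem affineForm_apply (a b c d : ℝ) (x : EuclideanSpace ℝ (Fin 3)) :
    affineForm a b c d x = a * x 0 + b * x 1 + c * x 2 + d := by
  simp [affineForm]

theorem affineForm_rimPoint (a b c d : ℝ) (N : ℕ) (z : ℕ → ℕ) (j : ℕ) :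
    affineForm a b c d (rimPoint N z j) = a * rimX N j + b * rimY N j + c * z j + d := by
  simp [affineForm_apply, rimPoint]

theorem affineForm_axisPoint (a b c d : ℝ) (m : ℕ) :
    affineForm a b c d (axisPoint m) = c * m + d := by
  simp [affineForm_apply, axisPoint]

/-- The functional whose kernel is the vertical plane through the axis and a rim point. -/
noncomputable def rimForm (N i : ℕ) : EuclideanSpace ℝ (Fin 3) →ᵃ[ℝ] ℝ :=
  affineForm (rimY N i) (-rimX N i) 0 0

theorem rimForm_rimPoint (N i : ℕ) (z : ℕ → ℕ) (j : ℕ) :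
    rimForm N i (rimPoint N z j) = (rimCross N i j : ℝ) := by
  rw [rimForm, affineForm_rimPoint, rimCross]; push_cast; ring

theorem rimForm_axisPoint (N i m : ℕ) : rimForm N i (axisPoint m) = 0 := by
  simp [rimForm, affineForm_axisPoint]

theorem rimCross_nonneg {N i j : ℕ} (hN : 2 ≤ N) (hij : i ≤ j) (hj : j < 2 * N) :
    0 ≤ rimCross N i j := by
  rcases hij.eq_or_lt with rfl | h
  · exact (rimCross_self N i).ge
  · exact (rimCross_pos hN h hj).le

theorem rimForm_nonneg {N i s t m : ℕ} {z : ℕ → ℕ} (hN : 2 ≤ N) (his : i ≤ s) (hst : s < t)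
    (ht : t < 2 * N) : ∀ x ∈ corners N z s t m, 0 ≤ rimForm N i x := by
  rintro x (rfl | rfl | rfl)
  · rw [rimForm_rimPoint]; exact_mod_cast rimCross_nonneg hN his (hst.trans ht)
  · rw [rimForm_rimPoint]; exact_mod_cast rimCross_nonneg hN (his.trans hst.le) ht
  · rw [rimForm_axisPoint]

theorem rimForm_nonpos {N i s t m : ℕ} {z : ℕ → ℕ} (hN : 2 ≤ N) (hst : s < t) (hti : t ≤ i)
    (hi : i < 2 * N) : ∀ x ∈ corners N z s t m, 0 ≤ (-rimForm N i) x := by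
  rintro x (rfl | rfl | rfl) <;> simp only [AffineMap.coe_neg, Pi.neg_apply]
  · rw [rimForm_rimPoint, rimCross_swap]
    push_cast
    rw [neg_neg]; exact_mod_cast rimCross_nonneg hN (hst.le.trans hti) hi
  · rw [rimForm_rimPoint, rimCross_swap]
    push_cast
    rw [neg_neg]; exact_mod_cast rimCross_nonneg hN hti hi
  · rw [rimForm_axisPoint, neg_zero]

/-- Triangles occupying non-overlapping stretches of the rim meet only in common corners. -/
theorem triangles_inter_subset_of_le {N s t m s' t' m' : ℕ} {z : ℕ → ℕ} (hN : 2 ≤ N)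
    (hst : s < t) (hts : t ≤ s') (hst' : s' < t') (ht' : t' < 2 * N)
    (hm : t = s' → m ≠ m') :
    convexHull ℝ (corners N z s t m) ∩ convexHull ℝ (corners N z s' t' m') ⊆
      corners N z s t m ∩ corners N z s' t' m' := by
  rintro x ⟨hx, hx'⟩
  have hfaces : ∀ i, t ≤ i → i ≤ s' →
      x ∈ convexHull ℝ (corners N z s t m ∩ {y | (-rimForm N i) y = 0}) ∧
      x ∈ convexHull ℝ (corners N z s' t' m' ∩ {y | rimForm N i y = 0}) := by
    intro i hti his
    have h1 := rimForm_nonpos (z := z) (m := m) hN hst hti (by omega)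
    have h2 := rimForm_nonneg (z := z) (m := m') hN his hst' ht'
    have hp1 : 0 ≤ (-rimForm N i) x :=
      convexHull_min (t := {y | 0 ≤ (-rimForm N i) y}) h1
        ((convex_Ici (0 : ℝ)).affine_preimage (-rimForm N i)) hx
    have hp2 : 0 ≤ rimForm N i x :=
      convexHull_min (t := {y | 0 ≤ rimForm N i y}) h2
        ((convex_Ici (0 : ℝ)).affine_preimage (rimForm N i)) hx'
    refine ⟨mem_convexHull_inter_of_nonneg h1 hx ?_, mem_convexHull_inter_of_nonneg h2 hx' ?_⟩
    · rw [AffineMap.coe_neg, Pi.neg_apply]; linarith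
    · rw [AffineMap.coe_neg, Pi.neg_apply] at hp1; linarith
  rcases hts.eq_or_lt with rfl | hlt
  · obtain ⟨h1, h2⟩ := hfaces t le_rfl le_rfl
    have s1 : corners N z s t m ∩ {y | (-rimForm N t) y = 0} ⊆ {rimPoint N z t, axisPoint m} := by
      rintro y ⟨rfl | rfl | rfl, hy⟩
      · rw [Set.mem_ofPred_eq, AffineMap.coe_neg, Pi.neg_apply, neg_eq_zero, rimForm_rimPoint,
          rimCross_swap] at hy
        have := rimCross_pos hN hst (hst'.trans ht')
        norm_cast at hy; omega
      · simp
      · simp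
    have s2 : corners N z t t' m' ∩ {y | rimForm N t y = 0} ⊆ {rimPoint N z t, axisPoint m'} := by
      rintro y ⟨rfl | rfl | rfl, hy⟩
      · simp
      · rw [Set.mem_ofPred_eq, rimForm_rimPoint] at hy
        have := rimCross_pos hN hst' ht'
        norm_cast at hy; omega
      · simp
    have h1' := convexHull_mono s1 h1
    have h2' := convexHull_mono s2 h2
    rw [convexHull_pair] at h1' h2'
    obtain ⟨a, b, ha, hb, hab, rfl⟩ := h1'
    obtain ⟨a', b', ha', hb', hab', he⟩ := h2'
    have e0 := congrArg (fun y => y 0) he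
    have e1 := congrArg (fun y => y 1) he
    have e2 := congrArg (fun y => y 2) he
    simp [rimPoint, axisPoint] at e0 e1 e2
    have hc := rimCross_pos hN hst (hst'.trans ht')
    have haa : a' = a := by
      rcases e0 with e0 | e0
      · exact e0
      rcases e1 with e1 | e1
      · exact e1
      · simp [rimCross, e0, e1] at hc
    have hbb : b' = b := by linarith
    subst haa hbb
    have : b' * ((m' : ℝ) - m) = 0 := by linarith
    rcases mul_eq_zero.mp this with h | h
    · have : a' = 1 := by linarith
      subst this h
      simp [corners]
    · exact absurd (by exact_mod_cast (sub_eq_zero.mp h).symm) (hm rfl)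
  · obtain ⟨h1, -⟩ := hfaces s' hlt.le le_rfl
    obtain ⟨-, h2⟩ := hfaces t le_rfl hlt.le
    have s1 : corners N z s t m ∩ {y | (-rimForm N s') y = 0} ⊆ {axisPoint m} := by
      rintro y ⟨rfl | rfl | rfl, hy⟩
      · rw [Set.mem_ofPred_eq, AffineMap.coe_neg, Pi.neg_apply, neg_eq_zero, rimForm_rimPoint,
          rimCross_swap] at hy
        have := rimCross_pos hN (hst.trans hlt) (hst'.trans ht')
        norm_cast at hy; omega
      · rw [Set.mem_ofPred_eq, AffineMap.coe_neg, Pi.neg_apply, neg_eq_zero, rimForm_rimPoint,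
          rimCross_swap] at hy
        have := rimCross_pos hN hlt (hst'.trans ht')
        norm_cast at hy; omega
      · simp
    have s2 : corners N z s' t' m' ∩ {y | rimForm N t y = 0} ⊆ {axisPoint m'} := by
      rintro y ⟨rfl | rfl | rfl, hy⟩
      · rw [Set.mem_ofPred_eq, rimForm_rimPoint] at hy
        have := rimCross_pos hN hlt (hst'.trans ht')
        norm_cast at hy; omega
      · rw [Set.mem_ofPred_eq, rimForm_rimPoint] at hy
        have := rimCross_pos hN (hlt.trans hst') ht'
        norm_cast at hy; omega
      · simp
    have h1' := convexHull_mono s1 h1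
    have h2' := convexHull_mono s2 h2
    rw [convexHull_singleton, Set.mem_singleton_iff] at h1' h2'
    constructor
    · rw [h1']; simp [corners]
    · rw [h2']; simp [corners]

/-- The functional vanishing on the plane through the axis point at height `m` and two
rim points at height zero. -/
noncomputable def chordForm (N s t m : ℕ) : EuclideanSpace ℝ (Fin 3) →ᵃ[ℝ] ℝ :=
  (m : ℝ) • (rimForm N s - rimForm N t) + affineForm 0 0 (rimCross N s t) (-(m * rimCross N s t))

theorem chordForm_rimPoint (N s t m : ℕ) (z : ℕ → ℕ) (j : ℕ) :
    chordForm N s t m (rimPoint N z j) =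
      m * ((rimCross N s j + rimCross N j t - rimCross N s t : ℤ) : ℝ)
        + rimCross N s t * z j := by
  simp only [chordForm, AffineMap.coe_add, AffineMap.coe_smul, AffineMap.coe_sub, Pi.add_apply,
    Pi.smul_apply, Pi.sub_apply, rimForm_rimPoint, affineForm_rimPoint, smul_eq_mul,
    rimCross_swap N j t]
  push_cast; ring

theorem chordForm_axisPoint (N s t m m' : ℕ) :
    chordForm N s t m (axisPoint m') = rimCross N s t * ((m' : ℝ) - m) := by
  simp only [chordForm, AffineMap.coe_add, AffineMap.coe_smul, AffineMap.coe_sub, Pi.add_apply,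
    Pi.smul_apply, Pi.sub_apply, rimForm_axisPoint, affineForm_axisPoint, smul_eq_mul]
  ring

/-- A triangle whose chord lies below a stretch of the rim, and whose axis point is no higher,
meets a triangle over that stretch only in a common corner. -/
theorem triangles_inter_subset_of_nested {N s t m s' t' m' : ℕ} {z : ℕ → ℕ} (hN : 2 ≤ N)
    (hss : s ≤ s') (hst' : s' < t') (htt : t' ≤ t) (ht : t < 2 * N)
    (hzs : z s = 0) (hzt : z t = 0) (hz : ∀ j, s < j → j < t → 0 < z j) (hmm : m ≤ m')
    (h₁ : ¬ (s = s' ∧ t = t')) (h₂ : ¬ (s = s' ∧ m = m')) (h₃ : ¬ (t = t' ∧ m = m')) :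
    convexHull ℝ (corners N z s t m) ∩ convexHull ℝ (corners N z s' t' m') ⊆
      corners N z s t m ∩ corners N z s' t' m' := by
  rintro x ⟨hx, hx'⟩
  have hst : s < t := by omega
  have hc : (0 : ℝ) < rimCross N s t := by exact_mod_cast rimCross_pos hN hst ht
  have hzero : ∀ y ∈ corners N z s t m, chordForm N s t m y = 0 := by
    rintro y (rfl | rfl | rfl)
    · simp [chordForm_rimPoint, rimCross_self, hzs]
    · simp [chordForm_rimPoint, rimCross_self, hzt]
    · simp [chordForm_axisPoint]
  have hrim : ∀ j, s ≤ j → j ≤ t → rimCross N s t * (z j : ℝ) ≤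
      chordForm N s t m (rimPoint N z j) := by
    intro j h h'
    rw [chordForm_rimPoint]
    have := rimCross_le_add (N := N) h h'
    have h2 : (0 : ℝ) ≤ ((rimCross N s j + rimCross N j t - rimCross N s t : ℤ) : ℝ) := by
      exact_mod_cast (by omega : (0 : ℤ) ≤ _)
    nlinarith [mul_nonneg (Nat.cast_nonneg (α := ℝ) m) h2]
  have hrim_nonneg : ∀ j, s ≤ j → j ≤ t → 0 ≤ chordForm N s t m (rimPoint N z j) :=
    fun j h h' => le_trans (by positivity) (hrim j h h')
  have hrim_eq : ∀ j, s ≤ j → j ≤ t → chordForm N s t m (rimPoint N z j) = 0 →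
      j = s ∨ j = t := by
    intro j h h' h0
    by_contra! hj
    have h3 : (0 : ℝ) < z j := by
      exact_mod_cast hz j (lt_of_le_of_ne h hj.1.symm) (lt_of_le_of_ne h' hj.2)
    have := hrim j h h'
    have := mul_pos hc h3
    linarith
  have hmm' : (0 : ℝ) ≤ (m' : ℝ) - m := sub_nonneg.mpr (by exact_mod_cast hmm)
  have hnonneg : ∀ y ∈ corners N z s' t' m', 0 ≤ chordForm N s t m y := by
    rintro y (rfl | rfl | rfl)
    · exact hrim_nonneg _ hss (by omega)
    · exact hrim_nonneg _ (by omega) htt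
    · rw [chordForm_axisPoint]; positivity
  have hx0 : chordForm N s t m x = 0 :=
    convexHull_min (t := {y | chordForm N s t m y = 0}) hzero
      ((convex_singleton (0 : ℝ)).affine_preimage (chordForm N s t m)) hx
  have hface := mem_convexHull_inter_of_nonneg hnonneg hx' hx0.le
  have hsub : corners N z s' t' m' ∩ {y | chordForm N s t m y = 0} ⊆
      corners N z s t m ∩ corners N z s' t' m' := by
    rintro y ⟨hy, hy0⟩
    refine ⟨?_, hy⟩
    rcases hy with rfl | rfl | rfl
    · rcases hrim_eq _ hss (by omega) hy0 with h | h
      · simp [corners, h]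
      · omega
    · rcases hrim_eq _ (by omega) htt hy0 with h | h
      · omega
      · simp [corners, h]
    · rw [Set.mem_ofPred_eq, chordForm_axisPoint] at hy0
      have h : (m' : ℝ) - m = 0 := (mul_eq_zero.mp hy0).resolve_left hc.ne'
      have h' : m' = m := by exact_mod_cast sub_eq_zero.mp h
      simp [corners, h']
  have hsingle : (corners N z s' t' m' ∩ {y | chordForm N s t m y = 0}).Subsingleton := by
    have hm0 : ∀ y, y = axisPoint m' → chordForm N s t m y = 0 → m' = m := by
      rintro y rfl hy0
      rw [chordForm_axisPoint] at hy0
      exact_mod_cast sub_eq_zero.mp ((mul_eq_zero.mp hy0).resolve_left hc.ne')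
    rintro y ⟨rfl | rfl | hy, hy0⟩ w ⟨rfl | rfl | hw, hw0⟩
    · rfl
    · have a := hrim_eq _ hss (by omega) hy0
      have b := hrim_eq _ (by omega) htt hw0
      omega
    · have a := hrim_eq _ hss (by omega) hy0
      have b := hm0 _ hw hw0
      omega
    · have a := hrim_eq _ hss (by omega) hw0
      have b := hrim_eq _ (by omega) htt hy0
      omega
    · rfl
    · have a := hrim_eq _ (by omega) htt hy0
      have b := hm0 _ hw hw0
      omega
    · have a := hrim_eq _ hss (by omega) hw0
      have b := hm0 _ hy hy0
      omega
    · have a := hrim_eq _ (by omega) htt hw0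
      have b := hm0 _ hy hy0
      omega
    · rw [hy, hw]
  rcases hsingle.eq_empty_or_singleton with h | ⟨y, h⟩
  · rw [h, convexHull_empty] at hface; exact hface.elim
  · rw [h, convexHull_singleton] at hface
    rw [h] at hsub
    exact hsub hface

theorem rimPoint_ne_of_lt {N i j : ℕ} {z : ℕ → ℕ} (hN : 2 ≤ N) (hij : i < j) (hj : j < 2 * N) :
    rimPoint N z i ≠ rimPoint N z j := by
  intro h
  have := congrArg (rimForm N i) h
  rw [rimForm_rimPoint, rimForm_rimPoint, rimCross_self] at this
  have h' := rimCross_pos hN hij hj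
  norm_cast at this; omega

theorem rimPoint_injOn {N i j : ℕ} {z : ℕ → ℕ} (hN : 2 ≤ N) (hi : i < 2 * N) (hj : j < 2 * N)
    (h : rimPoint N z i = rimPoint N z j) : i = j := by
  rcases lt_trichotomy i j with h' | h' | h'
  · exact absurd h (rimPoint_ne_of_lt hN h' hj)
  · exact h'
  · exact absurd h.symm (rimPoint_ne_of_lt hN h' hi)

theorem axisPoint_injective : Function.Injective axisPoint := by
  intro a b h
  have := congrArg (fun y => y 2) h
  simpa [axisPoint] using this

theorem rimPoint_ne_axisPoint {N i m : ℕ} {z : ℕ → ℕ} (hN : 2 ≤ N) (hi : i < 2 * N) :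
    rimPoint N z i ≠ axisPoint m := by
  intro h
  obtain ⟨k, hk, hne⟩ : ∃ k < 2 * N, k ≠ i := ⟨if i = 0 then 1 else 0, by split_ifs <;> omega,
    by split_ifs <;> omega⟩
  have := congrArg (rimForm N k) h
  rw [rimForm_rimPoint, rimForm_axisPoint] at this
  norm_cast at this
  rcases hne.lt_or_gt with h' | h'
  · have := rimCross_pos hN h' hi; omega
  · have := rimCross_pos hN h' hk
    rw [rimCross_swap] at this
    omega

theorem AffineIndependent.of_injective_of_mem {k V P ι : Type*} [Ring k] [AddCommGroup V]
    [Module k V] [AddTorsor V P] {S : Set P} (hS : AffineIndependent k ((↑) : S → P))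
    {f : ι → P} (hf : Function.Injective f) (hmem : ∀ i, f i ∈ S) : AffineIndependent k f :=
  hS.comp_embedding (f := (⟨fun i => ⟨f i, hmem i⟩, fun _ _ h => hf (congrArg Subtype.val h)⟩ :
    ι ↪ S))

theorem affineIndependent_corners {N s t m : ℕ} {z : ℕ → ℕ} (hN : 2 ≤ N) (hst : s < t)
    (ht : t < 2 * N) :
    AffineIndependent ℝ (fun x : corners N z s t m => (x : EuclideanSpace ℝ (Fin 3))) := by
  have : AffineIndependent ℝ ![axisPoint m, rimPoint N z s, rimPoint N z t] := by
    rw [affineIndependent_iff_linearIndependent_vsub ℝ _ (0 : Fin 3)]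
    rw [← linearIndependent_equiv (finSuccAboveEquiv (0 : Fin 3)),
      Fintype.linearIndependent_iff]
    intro g hg
    rw [Fin.sum_univ_two] at hg
    have hc : (0 : ℝ) < rimCross N s t := by exact_mod_cast rimCross_pos hN hst ht
    rw [rimCross] at hc
    push_cast at hc
    have e0 := congrArg (fun y => y 0) hg
    have e1 := congrArg (fun y => y 1) hg
    simp [finSuccAboveEquiv, axisPoint, rimPoint] at e0 e1
    have a0 : g 0 * ((rimX N t : ℝ) * rimY N s - rimX N s * rimY N t) = 0 := by
      linear_combination (rimX N t : ℝ) * e1 - (rimY N t : ℝ) * e0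
    have a1 : g 1 * ((rimX N t : ℝ) * rimY N s - rimX N s * rimY N t) = 0 := by
      linear_combination - (rimX N s : ℝ) * e1 + (rimY N s : ℝ) * e0
    have a0' := (mul_eq_zero.mp a0).resolve_right hc.ne'
    have a1' := (mul_eq_zero.mp a1).resolve_right hc.ne'
    intro i
    fin_cases i
    · exact a0'
    · exact a1'
  have h := this.range
  have hr : corners N z s t m ⊆ Set.range ![axisPoint m, rimPoint N z s, rimPoint N z t] := by
    rintro x (rfl | rfl | rfl)
    · exact ⟨1, rfl⟩
    · exact ⟨2, rfl⟩
    · exact ⟨0, rfl⟩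
  exact h.mono hr

open Finset in
/-- In a cubic graph, the number of edges leaving an odd set of vertices is odd. -/
theorem SimpleGraph.odd_card_interedges_compl {V : Type*} [Fintype V] [DecidableEq V]
    (G : SimpleGraph V) [DecidableRel G.Adj] (hcubic : ∀ v, G.degree v = 3)
    {S : Finset V} (hS : Odd #S) : Odd #(G.interedges S Sᶜ) := by
  have hsum : #(G.interedges S univ) = 3 * #S := by
    have h : #(G.interedges S univ) = ∑ v ∈ S, G.degree v := by
      rw [SimpleGraph.interedges, Rel.interedges, card_filter, sum_product]
      refine sum_congr rfl fun v _ => ?_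
      rw [← card_filter, ← G.card_neighborFinset_eq_degree, G.neighborFinset_eq_filter]
    simp [h, hcubic, mul_comm]
  have hsplit : #(G.interedges S univ) = #(G.interedges S S) + #(G.interedges S Sᶜ) := by
    rw [← card_union_of_disjoint (G.interedges_disjoint_right _ disjoint_compl_right),
      ← Finset.union_compl S]
    congr 1
    ext ⟨a, b⟩
    simp only [mem_union, SimpleGraph.mem_interedges_iff, mem_compl]
    tauto
  have heven : Even #(G.interedges S S) := by
    rw [← ZMod.natCast_eq_zero_iff_even, card_eq_sum_ones, Nat.cast_sum]
    refine sum_involution (fun x _ => x.swap) (fun _ _ => by decide) ?_ ?_ fun _ _ => rfl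
    · rintro ⟨a, b⟩ h - heq
      rw [SimpleGraph.mem_interedges_iff] at h
      exact h.2.2.ne (congrArg Prod.snd heq)
    · rintro ⟨a, b⟩ h
      rw [SimpleGraph.mem_interedges_iff] at h
      exact G.mem_interedges_iff.mpr ⟨h.2.1, h.1, h.2.2.symm⟩
  rw [hsplit] at hsum
  have h3 : Odd (3 * #S) := (by decide : Odd 3).mul hS
  rw [← hsum] at h3
  exact (Nat.odd_add'.mp h3).mpr heven

open Finset in
/-- In a bridgeless cubic graph, at least three edges leave any odd set of vertices. -/
theorem SimpleGraph.three_le_card_interedges_compl {V : Type*} [Fintype V] [DecidableEq V]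
    (G : SimpleGraph V) [DecidableRel G.Adj] (hcubic : ∀ v, G.degree v = 3)
    (hbridgeless : ∀ e : Sym2 V, ¬ G.IsBridge e) {S : Finset V} (hS : Odd #S) :
    3 ≤ #(G.interedges S Sᶜ) := by
  have hodd := G.odd_card_interedges_compl hcubic hS
  suffices #(G.interedges S Sᶜ) ≠ 1 by
    obtain ⟨k, hk⟩ := hodd
    omega
  intro h1
  obtain ⟨⟨u, w⟩, huw⟩ := card_eq_one.mp h1
  have hmem : (u, w) ∈ G.interedges S Sᶜ := by simp [huw]
  rw [SimpleGraph.mem_interedges_iff, mem_compl] at hmem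
  refine hbridgeless s(u, w) (isBridge_iff.mpr ?_)
  rintro ⟨q⟩
  obtain ⟨d, -, hd1, hd2⟩ := q.exists_boundary_dart (S : Set V) hmem.1 hmem.2.1
  have hadj := d.adj
  rw [SimpleGraph.deleteEdges_adj] at hadj
  have hd : (d.fst, d.snd) ∈ G.interedges S Sᶜ :=
    G.mem_interedges_iff.mpr ⟨hd1, by simpa using hd2, hadj.1⟩
  rw [huw, mem_singleton, Prod.mk.injEq] at hd
  exact hadj.2 (by simp [hd.1, hd.2])

open Finset in
/-- **Petersen's theorem**: every bridgeless cubic graph has a perfect matching. -/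
theorem SimpleGraph.exists_isPerfectMatching_of_cubic {V : Type*} [Fintype V] [DecidableEq V]
    (G : SimpleGraph V) [DecidableRel G.Adj] (hcubic : ∀ v, G.degree v = 3)
    (hbridgeless : ∀ e : Sym2 V, ¬ G.IsBridge e) : ∃ M : G.Subgraph, M.IsPerfectMatching := by
  classical
  refine SimpleGraph.tutte.mpr fun U hU => ?_
  let H := ((⊤ : G.Subgraph).deleteVerts U).coe
  let S : H.ConnectedComponent → Finset V := fun c => (Subtype.val '' c.supp).toFinset
  have hcard : ∀ c, #(S c) = c.supp.ncard := fun c => by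
    rw [← Set.ncard_eq_toFinset_card', Set.ncard_image_of_injective _ Subtype.val_injective]
  have hU' : U.ncard < #H.oddComponents.toFinset := by
    rw [← Set.ncard_eq_toFinset_card']; exact hU
  have hlower : 3 * #H.oddComponents.toFinset ≤
      ∑ c ∈ H.oddComponents.toFinset, #(G.interedges (S c) (S c)ᶜ) := by
    rw [mul_comm, ← smul_eq_mul]
    refine card_nsmul_le_sum _ _ _ fun c hc => ?_
    refine G.three_le_card_interedges_compl hcubic hbridgeless ?_
    rw [hcard]
    simpa using hc
  have hdisj : ∀ c ∈ H.oddComponents.toFinset, ∀ d ∈ H.oddComponents.toFinset, c ≠ d →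
      Disjoint (G.interedges (S c) (S c)ᶜ) (G.interedges (S d) (S d)ᶜ) := by
    rintro c - d - hcd
    rw [Finset.disjoint_left]
    rintro ⟨a, b⟩ h h'
    rw [SimpleGraph.mem_interedges_iff] at h h'
    obtain ⟨x, hx, hxa⟩ := Set.mem_toFinset.mp h.1
    obtain ⟨y, hy, hya⟩ := Set.mem_toFinset.mp h'.1
    have hxy : x = y := Subtype.ext (hxa.trans hya.symm)
    subst hxy
    exact hcd (hx.symm.trans hy)
  rw [← card_biUnion hdisj] at hlower
  have hsub : H.oddComponents.toFinset.biUnion (fun c => G.interedges (S c) (S c)ᶜ) ⊆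
      G.interedges univ U.toFinset := by
    intro ⟨a, b⟩ hab
    obtain ⟨c, -, h⟩ := mem_biUnion.mp hab
    rw [SimpleGraph.mem_interedges_iff, mem_compl] at h
    refine G.mem_interedges_iff.mpr ⟨mem_univ _, ?_, h.2.2⟩
    by_contra hb
    rw [Set.mem_toFinset] at hb
    obtain ⟨x, hx, hxa⟩ := Set.mem_toFinset.mp h.1
    subst hxa
    refine h.2.1 (Set.mem_toFinset.mpr ?_)
    refine ConnectedComponent.mem_coe_supp_of_adj ⟨x, hx, rfl⟩ ⟨trivial, hb⟩ ?_
    have := x.2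
    simp only [Subgraph.deleteVerts_adj, Subgraph.top_adj]
    exact ⟨trivial, this.2, trivial, hb, h.2.2⟩
  have hupper : #(G.interedges univ U.toFinset) = 3 * #U.toFinset := by
    have h : #(G.interedges univ U.toFinset) = ∑ v ∈ U.toFinset, G.degree v := by
      rw [SimpleGraph.interedges, Rel.interedges, card_filter, sum_product_right]
      refine sum_congr rfl fun v _ => ?_
      rw [← card_filter, ← G.card_neighborFinset_eq_degree, G.neighborFinset_eq_filter]
      simp only [G.adj_comm]
    simp [h, hcubic, mul_comm]
  have := card_le_card hsub
  rw [Set.ncard_eq_toFinset_card'] at hU'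
  omega

/-- The connected component of a vertex in a 2-regular finite graph is traversed by a closed
sequence of vertices starting at a vertex minimising a given function. -/
theorem SimpleGraph.IsCycles.exists_closed_enumeration {V : Type*} [Fintype V]
    {H : SimpleGraph V} (hcyc : H.IsCycles) (hne : ∀ v, (H.neighborSet v).Nonempty) (m : V → ℕ)
    (c : H.ConnectedComponent) :
    ∃ (k : ℕ) (g : ℕ → V), 3 ≤ k ∧ g k = g 0 ∧ (∀ v ∈ c.supp, ∃ i < k, g i = v) ∧
      (∀ i, g i ∈ c.supp) ∧ (∀ i < k, ∀ j < k, g i = g j → i = j) ∧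
      (∀ i < k, H.Adj (g i) (g (i + 1))) ∧
      (∀ u ∈ c.supp, ∀ w, H.Adj u w → ∃ i < k, s(g i, g (i + 1)) = s(u, w)) ∧
      ∀ v ∈ c.supp, m (g 0) ≤ m v := by
  classical
  obtain ⟨v, hv, hmin⟩ := Set.exists_min_image c.supp m (Set.toFinite _) c.nonempty_supp
  obtain ⟨p, hp, hverts⟩ := hcyc.exists_cycle_toSubgraph_verts_eq_connectedComponentSupp hv (hne v)
  have hmem : ∀ w, w ∈ p.support ↔ w ∈ c.supp := fun w => by
    rw [← hverts, Walk.mem_verts_toSubgraph]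
  have h3 := hp.three_le_length
  refine ⟨p.length, p.getVert, h3, by simp, ?_, ?_, ?_, ?_, ?_, by simpa using hmin⟩
  · intro w hw
    obtain ⟨i, hi, hil⟩ := Walk.mem_support_iff_exists_getVert.mp ((hmem w).mpr hw)
    rcases hil.eq_or_lt with rfl | hlt
    · exact ⟨0, by omega, by simpa using hi⟩
    · exact ⟨i, hlt, hi⟩
  · exact fun i => (hmem _).mp (p.getVert_mem_support i)
  · intro i hi j hj hij
    exact hp.getVert_injOn' (by simp; omega) (by simp; omega) hij
  · exact fun i hi => p.adj_getVert_succ hi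
  · intro u hu w huw
    have h := (hp.adj_toSubgraph_iff_of_isCycles hcyc (hverts.symm ▸ hu) w).mpr huw
    obtain ⟨i, hi, hil⟩ := p.toSubgraph_adj_iff.mp h
    exact ⟨i, hil, hi⟩

/-- The vertices of a 2-regular finite graph can be listed cycle by cycle, every cycle starting
at a vertex minimising a given function. -/
theorem SimpleGraph.IsCycles.exists_cycle_enumeration {V : Type*} [Fintype V] [Nonempty V]
    {H : SimpleGraph V} (hcyc : H.IsCycles) (hne : ∀ v, (H.neighborSet v).Nonempty) (m : V → ℕ) :
    ∃ (r : ℕ) (k : ℕ → ℕ) (g : ℕ → ℕ → V), (∀ c, 3 ≤ k c) ∧ (∀ c, g c (k c) = g c 0) ∧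
      (∀ v, ∃ c < r, ∃ i < k c, g c i = v) ∧
      (∀ c < r, ∀ i < k c, ∀ c' < r, ∀ i' < k c', g c i = g c' i' → c = c' ∧ i = i') ∧
      (∀ c, ∀ i < k c, H.Adj (g c i) (g c (i + 1))) ∧
      (∀ u w, H.Adj u w → ∃ c < r, ∃ i < k c, s(g c i, g c (i + 1)) = s(u, w)) ∧
      ∀ c i, m (g c 0) ≤ m (g c i) := by
  classical
  choose k g h3 hclosed hsurj hmem hinj hadj hcover hmin using
    hcyc.exists_closed_enumeration hne m
  let e := Fintype.equivFin H.ConnectedComponent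
  let C : ℕ → H.ConnectedComponent := fun n =>
    if h : n < Fintype.card H.ConnectedComponent then e.symm ⟨n, h⟩
    else H.connectedComponentMk (Classical.arbitrary V)
  have hC : ∀ c, ∃ n < Fintype.card H.ConnectedComponent, C n = c := fun c =>
    ⟨e c, (e c).2, by simp [C]⟩
  have hCinj : ∀ a < Fintype.card H.ConnectedComponent,
      ∀ b < Fintype.card H.ConnectedComponent, C a = C b → a = b := by
    intro a ha b hb h
    simpa [C, ha, hb] using h
  refine ⟨Fintype.card H.ConnectedComponent, fun n => k (C n), fun n => g (C n),
    fun n => h3 _, fun n => hclosed _, ?_, ?_, fun n => hadj _, ?_, ?_⟩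
  · intro v
    obtain ⟨n, hn, hv⟩ := hC (H.connectedComponentMk v)
    exact ⟨n, hn, hsurj (C n) v (by simp [hv])⟩
  · intro c hc i hi c' hc' i' hi' h
    have hcc : C c = C c' := by
      have h1 := hmem (C c) i
      have h2 := hmem (C c') i'
      rw [show g (C c) i = g (C c') i' from h] at h1
      exact ConnectedComponent.eq_of_common_vertex h1 h2
    obtain rfl := hCinj c hc c' hc' hcc
    exact ⟨rfl, hinj _ i hi i' hi' h⟩
  · intro u w huw
    obtain ⟨n, hn, hv⟩ := hC (H.connectedComponentMk u)
    exact ⟨n, hn, hcover (C n) u (by simp [hv]) w huw⟩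
  · exact fun c i => hmin _ _ (hmem _ _)

/-- Every number below the sum of consecutive block lengths lies in one of the blocks. -/
theorem exists_block_of_lt_sum {k : ℕ → ℕ} {r j : ℕ} (hj : j < ∑ c ∈ Finset.range r, k c) :
    ∃ c < r, ∃ i < k c, j = (∑ b ∈ Finset.range c, k b) + i := by
  induction r with
  | zero => simp at hj
  | succ r ih =>
    rcases lt_or_ge j (∑ c ∈ Finset.range r, k c) with h | h
    · obtain ⟨c, hc, i, hi, hji⟩ := ih h
      exact ⟨c, by omega, i, hi, hji⟩
    · rw [Finset.sum_range_succ] at hj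
      exact ⟨r, by omega, j - ∑ c ∈ Finset.range r, k c, by omega, by omega⟩

theorem block_end_le {k : ℕ → ℕ} {c c' : ℕ} (h : c < c') :
    (∑ b ∈ Finset.range c, k b) + k c ≤ ∑ b ∈ Finset.range c', k b := by
  rw [← Finset.sum_range_succ]
  exact Finset.sum_le_sum_of_subset (Finset.range_subset_range.mpr h)

theorem block_unique {k : ℕ → ℕ} {c c' i i' : ℕ} (hi : i < k c) (hi' : i' < k c')
    (h : (∑ b ∈ Finset.range c, k b) + i = (∑ b ∈ Finset.range c', k b) + i') :
    c = c' ∧ i = i' := by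
  rcases lt_trichotomy c c' with hc | rfl | hc
  · have := block_end_le (k := k) hc; omega
  · exact ⟨rfl, by omega⟩
  · have := block_end_le (k := k) hc; omega

/-- The stretch `[s u, t u]` of the rim contains the stretch of `v`, has its ends at height zero
and its inner points higher up, and the mark of `u` is at most the mark of `v`. -/
def NestedStretch {V : Type*} (s t m : V → ℕ) (z : ℕ → ℕ) (u v : V) : Prop :=
  s u ≤ s v ∧ t v ≤ t u ∧ z (s u) = 0 ∧ z (t u) = 0 ∧
    (∀ j, s u < j → j < t u → 0 < z j) ∧ m u ≤ m v

open Finset in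
/-- The edges of a 2-regular graph can be listed so that the two edges at any vertex are
consecutive, except for one vertex per cycle, which carries the first and the last edge. -/
theorem SimpleGraph.IsCycles.exists_rim_layout {V : Type*} [Fintype V] [Nonempty V]
    {H : SimpleGraph V} (hcyc : H.IsCycles) (hne : ∀ v, (H.neighborSet v).Nonempty) (m : V → ℕ) :
    ∃ (E : ℕ → Sym2 V) (s t : V → ℕ) (z : ℕ → ℕ),
      (∀ j < Fintype.card V, E j ∈ H.edgeSet) ∧
      (∀ e ∈ H.edgeSet, ∃ j < Fintype.card V, E j = e) ∧
      (∀ v, ∀ j < Fintype.card V, v ∈ E j ↔ j = s v ∨ j = t v) ∧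
      (∀ v, s v < t v) ∧ (∀ v, t v < Fintype.card V) ∧ (∀ j, z j ≤ 1) ∧
      ∀ u v, u ≠ v → t u ≤ s v ∨ t v ≤ s u ∨ NestedStretch s t m z u v ∨
        NestedStretch s t m z v u := by
  classical
  obtain ⟨r, k, g, h3, hclosed, hsurj, hinj, hadj, hcover, hmin⟩ :=
    hcyc.exists_cycle_enumeration hne m
  set off : ℕ → ℕ := fun c => ∑ b ∈ Finset.range c, k b with hoff
  have hcard : off r = Fintype.card V := by
    have h : #((Finset.range r).sigma fun c => Finset.range (k c)) = #(Finset.univ : Finset V) := by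
      refine Finset.card_bij (fun x _ => g x.1 x.2) (fun _ _ => Finset.mem_univ _) ?_ ?_
      · rintro ⟨c, i⟩ hx ⟨c', i'⟩ hx' h
        simp only [Finset.mem_sigma, Finset.mem_range] at hx hx'
        obtain ⟨rfl, rfl⟩ := hinj c hx.1 i hx.2 c' hx'.1 i' hx'.2 h
        rfl
      · intro v _
        obtain ⟨c, hc, i, hi, h⟩ := hsurj v
        exact ⟨⟨c, i⟩, by simp [hc, hi], h⟩
    simpa [hoff] using h
  choose C hC I hI hg using hsurj
  have hend : ∀ {c c'}, c < c' → off c + k c ≤ off c' := fun h => block_end_le h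
  have huniq : ∀ {c c' i i'}, i < k c → i' < k c' → off c + i = off c' + i' → c = c' ∧ i = i' :=
    fun hi hi' h => block_unique hi hi' h
  have hlt : ∀ {c i}, c < r → i < k c → off c + i < Fintype.card V := fun hc hi => by
    have := hend hc
    omega
  have hblock : ∀ j, ∃ c i, j < Fintype.card V → c < r ∧ i < k c ∧ j = off c + i := by
    intro j
    by_cases hj : j < Fintype.card V
    · obtain ⟨c, hc, i, hi, h⟩ := exists_block_of_lt_sum (hcard.symm ▸ hj : j < off r)
      exact ⟨c, i, fun _ => ⟨hc, hi, h⟩⟩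
    · exact ⟨0, 0, fun h => absurd h hj⟩
  choose bc bi hb using hblock
  have hdecode : ∀ c < r, ∀ i < k c, bc (off c + i) = c ∧ bi (off c + i) = i := by
    intro c hc i hi
    obtain ⟨h1, h2, h3⟩ := hb _ (hlt hc hi)
    have := huniq hi h2 h3
    exact ⟨this.1.symm, this.2.symm⟩
  refine ⟨fun j => s(g (bc j) (bi j), g (bc j) (bi j + 1)),
    fun v => if I v = 0 then off (C v) else off (C v) + (I v - 1),
    fun v => if I v = 0 then off (C v) + (k (C v) - 1) else off (C v) + I v,
    fun j => if bi j = 0 ∨ bi j + 1 = k (bc j) then 0 else 1, ?_, ?_, ?_, ?_, ?_, ?_, ?_⟩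
  · intro j hj
    exact hadj _ _ (hb j hj).2.1
  · intro e he
    induction e with
    | _ u w =>
      obtain ⟨c, hc, i, hi, h⟩ := hcover u w he
      refine ⟨off c + i, hlt hc hi, ?_⟩
      dsimp only
      rw [(hdecode c hc i hi).1, (hdecode c hc i hi).2, h]
  · intro v j hj
    obtain ⟨hc, hi, hji⟩ := hb j hj
    dsimp only
    generalize bc j = c at *
    generalize bi j = i at *
    subst hji
    have h3v := h3 (C v)
    have hCv := hC v
    have hIv := hI v
    have key : ∀ i' < k c, v = g c i' ↔ C v = c ∧ I v = i' := by
      intro i' hi'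
      conv_lhs => rw [← hg v]
      constructor
      · exact hinj _ (hC v) _ (hI v) _ hc _ hi'
      · rintro ⟨h, h'⟩; rw [h, h']
    have heq : ∀ i' < k (C v), off c + i = off (C v) + i' ↔ C v = c ∧ i' = i := by
      intro i' hi'
      constructor
      · intro h
        have := huniq hi hi' h
        exact ⟨this.1.symm, this.2.symm⟩
      · rintro ⟨rfl, rfl⟩; rfl
    rw [Sym2.mem_iff, key i hi]
    have hnext : v = g c (i + 1) ↔ C v = c ∧ I v = if i + 1 = k c then 0 else i + 1 := by
      split_ifs with h
      · rw [h, hclosed, key 0 (by omega)]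
      · rw [key (i + 1) (by omega)]
    rw [hnext]
    by_cases h0 : I v = 0
    · simp only [h0, if_true]
      rw [heq (k (C v) - 1) (by omega)]
      have := heq 0 (by omega)
      rw [add_zero] at this
      rw [this]
      by_cases hcc : C v = c
      · rw [hcc] at h3v ⊢
        have hlast : k c - 1 = i ↔ i + 1 = k c := by omega
        simp only [true_and, hlast]
        split_ifs with hik
        · simp [hik]
        · simp [hik]
      · simp [hcc]
    · simp only [h0, if_false]
      rw [heq (I v - 1) (by omega), heq (I v) (by omega)]
      by_cases hcc : C v = c
      · rw [hcc] at hIv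
        simp only [hcc, true_and]
        split_ifs <;> omega
      · simp [hcc]
  · intro v
    have := h3 (C v)
    dsimp only
    split_ifs <;> omega
  · intro v
    have := h3 (C v)
    have := hlt (hC v) (hI v)
    have := hlt (hC v) (i := k (C v) - 1) (by omega)
    dsimp only
    split_ifs <;> omega
  · intro j
    dsimp only
    split_ifs <;> omega
  · intro u v huv
    have hu3 := h3 (C u)
    have hv3 := h3 (C v)
    have hIu := hI u
    have hIv := hI v
    have hz : ∀ w, I w = 0 → ∀ j, off (C w) ≤ j → j ≤ off (C w) + (k (C w) - 1) →
        (bi j = 0 ∨ bi j + 1 = k (bc j) ↔ j = off (C w) ∨ j = off (C w) + (k (C w) - 1)) := by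
      intro w hw j h1 h2
      have hw3 := h3 (C w)
      obtain ⟨d, rfl⟩ := Nat.exists_eq_add_of_le h1
      obtain ⟨e1, e2⟩ := hdecode (C w) (hC w) d (by omega)
      rw [e1, e2]
      omega
    have hnest : ∀ u v, I u = 0 → I v ≠ 0 → C u = C v → NestedStretch
        (fun v => if I v = 0 then off (C v) else off (C v) + (I v - 1))
        (fun v => if I v = 0 then off (C v) + (k (C v) - 1) else off (C v) + I v) m
        (fun j => if bi j = 0 ∨ bi j + 1 = k (bc j) then 0 else 1) u v := by
      intro u v hu hv hcuv
      have hu3 := h3 (C u)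
      have hIv := hI v
      have hzu := hz u hu
      simp only [NestedStretch, hu, hv, if_true, if_false]
      refine ⟨?_, ?_, ?_, ?_, ?_, ?_⟩
      · rw [hcuv]; omega
      · rw [hcuv]; omega
      · exact if_pos ((hzu _ le_rfl (by omega)).mpr (by omega))
      · exact if_pos ((hzu _ (by omega) le_rfl).mpr (by omega))
      · intro j h1 h2
        rw [if_neg (fun h => by have := (hzu j h1.le h2.le).mp h; omega)]
        exact one_pos
      · rw [← hg u, ← hg v, hu, hcuv]; exact hmin _ _
    rcases lt_trichotomy (C u) (C v) with hc | hc | hc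
    · left
      have := hend hc
      dsimp only
      split_ifs <;> omega
    · by_cases hu : I u = 0 <;> by_cases hv : I v = 0
      · exact absurd (by rw [← hg u, ← hg v, hu, hv, hc]) huv
      · exact Or.inr (Or.inr (Or.inl (hnest u v hu hv hc)))
      · exact Or.inr (Or.inr (Or.inr (hnest v u hv hu hc.symm)))
      · have : I u ≠ I v := fun h => huv (by rw [← hg u, ← hg v, h, hc])
        simp only [hu, hv, if_false, hc]
        omega
    · right; left
      have := hend hc
      dsimp only
      split_ifs <;> omega

open Finset in
/-- Removing a 1-regular spanning subgraph from a cubic graph leaves disjoint cycles. -/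
theorem SimpleGraph.ncard_neighborSet_sdiff_of_cubic {V : Type*} [Fintype V] [DecidableEq V]
    {G F : SimpleGraph V} [DecidableRel G.Adj] [DecidableRel F.Adj]
    (hcubic : ∀ v, G.degree v = 3) (hFG : F ≤ G) (hF : ∀ v, F.degree v = 1) (v : V) :
    ((G \ F).neighborSet v).ncard = 2 := by
  have h : (G \ F).neighborSet v = ↑(G.neighborFinset v \ F.neighborFinset v) := by
    ext w
    simp
  rw [h, Set.ncard_coe_finset, card_sdiff_of_subset, G.card_neighborFinset_eq_degree,
    F.card_neighborFinset_eq_degree, hcubic, hF]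
  intro w
  simpa using fun hw => hFG hw

open Finset in
/-- The edges of a 1-regular graph can be numbered so that every vertex lies on a unique one. -/
theorem SimpleGraph.exists_matching_numbering {V : Type*} [Fintype V] [DecidableEq V]
    [Nonempty V] {F : SimpleGraph V} [DecidableRel F.Adj] (hF : ∀ v, F.degree v = 1) {N : ℕ}
    (hN : Fintype.card V = 2 * N) :
    ∃ (A : ℕ → Sym2 V) (m : V → ℕ), (∀ j < N, A j ∈ F.edgeSet) ∧
      (∀ e ∈ F.edgeSet, ∃ j < N, A j = e) ∧ (∀ v, ∀ j < N, v ∈ A j ↔ j = m v) ∧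
      ∀ v, m v < N := by
  have hcard : Fintype.card F.edgeSet = N := by
    have h := F.sum_degrees_eq_twice_card_edges
    rw [SimpleGraph.edgeFinset_card] at h
    simp only [hF, sum_const, card_univ, smul_eq_mul, mul_one] at h
    omega
  let e := Fintype.equivFinOfCardEq hcard
  have hmate : ∀ v, ∃ w, F.Adj v w ∧ ∀ x, F.Adj v x → x = w := fun v => by
    obtain ⟨w, hw⟩ := card_eq_one.mp ((F.card_neighborFinset_eq_degree v).trans (hF v))
    refine ⟨w, ?_, fun x hx => ?_⟩
    · rw [← F.mem_neighborFinset, hw, mem_singleton]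
    · rwa [← F.mem_neighborFinset, hw, mem_singleton] at hx
  choose mate hadj huniq using hmate
  have hedge : ∀ v, ∀ f : F.edgeSet, v ∈ (f : Sym2 V) ↔ f = ⟨s(v, mate v), F.mem_edgeSet.mpr (hadj v)⟩ := by
    rintro v ⟨f, hf⟩
    rw [Subtype.mk.injEq]
    constructor
    · intro hv
      obtain ⟨w, rfl⟩ := Sym2.mem_iff_exists.mp hv
      rw [huniq v w hf]
    · rintro rfl
      exact Sym2.mem_mk_left _ _
  refine ⟨fun j => if h : j < N then (e.symm ⟨j, h⟩ : Sym2 V) else Sym2.diag (Classical.arbitrary V),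
    fun v => e ⟨s(v, mate v), F.mem_edgeSet.mpr (hadj v)⟩, ?_, ?_, ?_, ?_⟩
  · intro j hj
    simp [hj]
  · intro f hf
    exact ⟨e ⟨f, hf⟩, (e ⟨f, hf⟩).2, by simp⟩
  · intro v j hj
    simp only [hj, dif_pos]
    rw [hedge, Equiv.symm_apply_eq, Fin.ext_iff]
  · exact fun v => (e _).2

theorem rim_grid_bounds {N j : ℕ} (hN : 2 ≤ N) (hj : j < 2 * N) :
    -1 ≤ rimX N j ∧ rimX N j < 2 ∧ 0 ≤ rimY N j ∧ rimY N j < N := by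
  unfold rimX rimY
  split_ifs <;> omega

/-- The contact point attached to the `j`-th rim edge or to the `k`-th matching edge. -/
def contactPoint (N : ℕ) (z : ℕ → ℕ) : Fin (2 * N) ⊕ Fin N → EuclideanSpace ℝ (Fin 3) :=
  Sum.elim (fun j => rimPoint N z j) (fun k => axisPoint k)

theorem contactPoint_injective {N : ℕ} {z : ℕ → ℕ} (hN : 2 ≤ N) :
    Function.Injective (contactPoint N z) := by
  rintro (i | i) (j | j) h
  · exact congrArg Sum.inl (Fin.ext (rimPoint_injOn hN i.2 j.2 h))
  · exact absurd h (rimPoint_ne_axisPoint hN i.2)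
  · exact absurd h.symm (rimPoint_ne_axisPoint hN j.2)
  · exact congrArg Sum.inr (Fin.ext (axisPoint_injective h))

theorem contactPoint_mem_grid {N : ℕ} {z : ℕ → ℕ} (hN : 2 ≤ N) (hz : ∀ j, z j ≤ 1)
    (y : Fin (2 * N) ⊕ Fin N) :
    ∃ a b c : ℤ, contactPoint N z y 0 = a ∧ contactPoint N z y 1 = b ∧ contactPoint N z y 2 = c ∧
      -1 ≤ a ∧ a < -1 + 3 ∧ 0 ≤ b ∧ b < 0 + (N : ℕ) ∧ 0 ≤ c ∧ c < 0 + (N : ℕ) := by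
  rcases y with j | k
  · obtain ⟨h1, h2, h3, h4⟩ := rim_grid_bounds hN j.2
    have := hz j
    refine ⟨rimX N j, rimY N j, z j, by simp [contactPoint, rimPoint],
      by simp [contactPoint, rimPoint], by simp [contactPoint, rimPoint], ?_⟩
    omega
  · have := k.2
    refine ⟨0, 0, k, by simp [contactPoint, axisPoint], by simp [contactPoint, axisPoint],
      by simp [contactPoint, axisPoint], ?_⟩
    omega

/-- **Lemma 3 of the paper.** Every 2-edge-connected cubic graph with `n`
vertices can be realized as a contact graph of triangles with vertices on an integer grid
of size `3 × n/2 × n/2`. -/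
theorem two_edge_connected_cubic_triangle_representation
    {V : Type*} [Fintype V] [DecidableEq V] (G : SimpleGraph V) [DecidableRel G.Adj]
    (n : ℕ) (hn : n = Fintype.card V)
    (hcubic : ∀ v, G.degree v = 3)
    (hconn : G.Connected)
    (hbridgeless : ∀ e : Sym2 V, ¬ G.IsBridge e) :
    ∃ (p : G.edgeSet → EuclideanSpace ℝ (Fin 3)) (x0 y0 z0 : ℤ),
      Function.Injective p ∧
      -- all contact points lie on an integer grid of size 3 × n/2 × n/2
      (∀ e : G.edgeSet, ∃ a b c : ℤ,
        p e 0 = (a : ℝ) ∧ p e 1 = (b : ℝ) ∧ p e 2 = (c : ℝ) ∧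
        x0 ≤ a ∧ a < x0 + 3 ∧
        y0 ≤ b ∧ b < y0 + (n / 2 : ℕ) ∧
        z0 ≤ c ∧ c < z0 + (n / 2 : ℕ)) ∧
      -- for each vertex, the three incident contact points are affinely independent
      (∀ v : V, AffineIndependent ℝ
        (fun e : {e : G.edgeSet // v ∈ (e : Sym2 V)} => p e.1)) ∧
      -- triangles of adjacent vertices meet exactly in the contact point of their edge
      (∀ u v (huv : G.Adj u v),
        convexHull ℝ {x | ∃ e : G.edgeSet, u ∈ (e : Sym2 V) ∧ x = p e} ∩
          convexHull ℝ {x | ∃ e : G.edgeSet, v ∈ (e : Sym2 V) ∧ x = p e} =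
          {p ⟨s(u, v), G.mem_edgeSet.mpr huv⟩}) ∧
      -- triangles of distinct non-adjacent vertices are disjoint
      (∀ u v, u ≠ v → ¬ G.Adj u v →
        convexHull ℝ {x | ∃ e : G.edgeSet, u ∈ (e : Sym2 V) ∧ x = p e} ∩
          convexHull ℝ {x | ∃ e : G.edgeSet, v ∈ (e : Sym2 V) ∧ x = p e} = ∅) := by
  classical
  obtain ⟨M, hM⟩ := G.exists_isPerfectMatching_of_cubic hcubic hbridgeless
  let F := M.spanningCoe
  have hFG : F ≤ G := M.spanningCoe_le
  have hF : ∀ v, F.degree v = 1 := fun v => by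
    rw [M.degree_spanningCoe]
    convert SimpleGraph.Subgraph.isPerfectMatching_iff_forall_degree.mp hM v
  have : Nonempty V := hconn.nonempty
  obtain ⟨N, hcard⟩ : ∃ N, Fintype.card V = 2 * N := by
    have h := F.sum_degrees_eq_twice_card_edges
    simp only [hF, Finset.sum_const, Finset.card_univ, smul_eq_mul, mul_one] at h
    exact ⟨_, h⟩
  have hN : 2 ≤ N := by
    have h := G.degree_lt_card_verts (Classical.arbitrary V)
    rw [hcubic, hcard] at h
    omega
  have hn2 : n / 2 = N := by omega
  have hedges : Fintype.card G.edgeSet = 3 * N := by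
    have h := G.sum_degrees_eq_twice_card_edges
    rw [SimpleGraph.edgeFinset_card] at h
    simp only [hcubic, Finset.sum_const, Finset.card_univ, smul_eq_mul, hcard] at h
    omega
  obtain ⟨A, m, hA, hAsurj, hAmem, hmN⟩ := SimpleGraph.exists_matching_numbering hF hcard
  have hH := SimpleGraph.ncard_neighborSet_sdiff_of_cubic hcubic hFG hF
  obtain ⟨E, s, t, z, hE, hEsurj, hEmem, hst, htN, hz, hpos⟩ :=
    SimpleGraph.IsCycles.exists_rim_layout (H := G \ F) (fun v _ => hH v)
      (fun v => Set.nonempty_of_ncard_ne_zero (by rw [hH v]; decide)) m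
  rw [hcard] at hE hEsurj hEmem htN
  let q : Fin (2 * N) ⊕ Fin N → G.edgeSet := Sum.elim
    (fun j => ⟨E j, SimpleGraph.edgeSet_mono sdiff_le (hE j j.2)⟩)
    (fun k => ⟨A k, SimpleGraph.edgeSet_mono hFG (hA k k.2)⟩)
  have hq : Function.Bijective q := by
    rw [Fintype.bijective_iff_surjective_and_card]
    refine ⟨?_, by simp [hedges]; omega⟩
    rintro ⟨e, he⟩
    by_cases heF : e ∈ F.edgeSet
    · obtain ⟨k, hk, h⟩ := hAsurj e heF
      exact ⟨Sum.inr ⟨k, hk⟩, Subtype.ext h⟩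
    · obtain ⟨j, hj, h⟩ := hEsurj e (by rw [SimpleGraph.edgeSet_sdiff]; exact ⟨he, heF⟩)
      exact ⟨Sum.inl ⟨j, hj⟩, Subtype.ext h⟩
  obtain ⟨Q, hQE, hQA⟩ : ∃ Q : Fin (2 * N) ⊕ Fin N ≃ G.edgeSet,
      (∀ j, (Q (Sum.inl j) : Sym2 V) = E j) ∧ ∀ k, (Q (Sum.inr k) : Sym2 V) = A k :=
    ⟨Equiv.ofBijective q hq, fun _ => rfl, fun _ => rfl⟩
  obtain ⟨p, hpQ⟩ : ∃ p : G.edgeSet → EuclideanSpace ℝ (Fin 3),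
      ∀ y, p (Q y) = contactPoint N z y :=
    ⟨fun e => contactPoint N z (Q.symm e), fun y => congrArg (contactPoint N z) (Q.symm_apply_apply y)⟩
  have hp : Function.Injective p := by
    rw [← Q.injective_comp]
    exact (funext hpQ : p ∘ Q = _) ▸ contactPoint_injective hN
  have hcorners : ∀ v, {x | ∃ e : G.edgeSet, v ∈ (e : Sym2 V) ∧ x = p e} =
      corners N z (s v) (t v) (m v) := by
    intro v
    ext x
    constructor
    · rintro ⟨e, hv, rfl⟩
      obtain ⟨y, rfl⟩ := Q.surjective e
      rw [hpQ]
      rcases y with j | k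
      · rw [hQE] at hv
        rcases (hEmem v j j.2).mp hv with h | h
        · exact Or.inl (congrArg (rimPoint N z) h)
        · exact Or.inr (Or.inl (congrArg (rimPoint N z) h))
      · rw [hQA] at hv
        exact Or.inr (Or.inr (congrArg axisPoint ((hAmem v k k.2).mp hv)))
    · rintro (rfl | rfl | rfl)
      · have h := (hst v).trans (htN v)
        exact ⟨Q (Sum.inl ⟨s v, h⟩), by rw [hQE]; exact (hEmem v _ h).mpr (Or.inl rfl),
          (hpQ (Sum.inl ⟨s v, h⟩)).symm⟩
      · exact ⟨Q (Sum.inl ⟨t v, htN v⟩), by rw [hQE]; exact (hEmem v _ (htN v)).mpr (Or.inr rfl),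
          (hpQ (Sum.inl ⟨t v, htN v⟩)).symm⟩
      · exact ⟨Q (Sum.inr ⟨m v, hmN v⟩), by rw [hQA]; exact (hAmem v _ (hmN v)).mpr rfl,
          (hpQ (Sum.inr ⟨m v, hmN v⟩)).symm⟩
  have hone : ∀ u v, u ≠ v → ∀ x x', x ∈ corners N z (s u) (t u) (m u) →
      x ∈ corners N z (s v) (t v) (m v) → x' ∈ corners N z (s u) (t u) (m u) →
      x' ∈ corners N z (s v) (t v) (m v) → x = x' := by
    intro u v huv x x' h1 h2 h3 h4
    rw [← hcorners] at h1 h2 h3 h4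
    obtain ⟨e1, hu1, rfl⟩ := h1
    obtain ⟨e2, hv2, h2⟩ := h2
    obtain ⟨e3, hu3, rfl⟩ := h3
    obtain ⟨e4, hv4, h4⟩ := h4
    obtain rfl := hp h2
    obtain rfl := hp h4
    exact congrArg p (Subtype.ext (((Sym2.mem_and_mem_iff huv).mp ⟨hu1, hv2⟩).trans
      ((Sym2.mem_and_mem_iff huv).mp ⟨hu3, hv4⟩).symm))
  have hrim : ∀ i j, i < j → j < 2 * N → rimPoint N z i ≠ rimPoint N z j :=
    fun i j => rimPoint_ne_of_lt hN
  have hrimaxis : ∀ i k, i < 2 * N → rimPoint N z i ≠ axisPoint k :=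
    fun i k => rimPoint_ne_axisPoint hN
  have hle : ∀ u v, u ≠ v → t u ≤ s v →
      convexHull ℝ (corners N z (s u) (t u) (m u)) ∩ convexHull ℝ (corners N z (s v) (t v) (m v)) ⊆
      corners N z (s u) (t u) (m u) ∩ corners N z (s v) (t v) (m v) := by
    intro u v huv h
    refine triangles_inter_subset_of_le hN (hst u) h (hst v) (htN v) fun h1 h2 => ?_
    exact hrimaxis (t u) (m u) (htN u) (hone u v huv _ _ (by simp [corners])
      (by simp [corners, h1]) (by simp [corners]) (by simp [corners, h2]))
  have hnested : ∀ u v, u ≠ v → NestedStretch s t m z u v →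
      convexHull ℝ (corners N z (s u) (t u) (m u)) ∩ convexHull ℝ (corners N z (s v) (t v) (m v)) ⊆
      corners N z (s u) (t u) (m u) ∩ corners N z (s v) (t v) (m v) := by
    rintro u v huv ⟨h1, h2, h3, h4, h5, h6⟩
    refine triangles_inter_subset_of_nested hN h1 (hst v) h2 (htN u) h3 h4 h5 h6 ?_ ?_ ?_
    · rintro ⟨a, b⟩
      exact hrim (s u) (t u) (hst u) (htN u) (hone u v huv _ _ (by simp [corners])
        (by simp [corners, a]) (by simp [corners]) (by simp [corners, b]))
    · rintro ⟨a, b⟩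
      exact hrimaxis (s u) (m u) ((hst u).trans (htN u)) (hone u v huv _ _ (by simp [corners])
        (by simp [corners, a]) (by simp [corners]) (by simp [corners, b]))
    · rintro ⟨a, b⟩
      exact hrimaxis (t u) (m u) (htN u) (hone u v huv _ _ (by simp [corners])
        (by simp [corners, a]) (by simp [corners]) (by simp [corners, b]))
  have hinter : ∀ u v, u ≠ v →
      convexHull ℝ (corners N z (s u) (t u) (m u)) ∩ convexHull ℝ (corners N z (s v) (t v) (m v)) ⊆
      corners N z (s u) (t u) (m u) ∩ corners N z (s v) (t v) (m v) := by
    intro u v huv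
    rcases hpos u v huv with h | h | h | h
    · exact hle u v huv h
    · rw [Set.inter_comm, Set.inter_comm (corners _ _ _ _ _)]
      exact hle v u huv.symm h
    · exact hnested u v huv h
    · rw [Set.inter_comm, Set.inter_comm (corners _ _ _ _ _)]
      exact hnested v u huv.symm h
  refine ⟨p, -1, 0, 0, hp, ?_, ?_, ?_, ?_⟩
  · intro e
    obtain ⟨y, rfl⟩ := Q.surjective e
    rw [hn2, hpQ]
    exact contactPoint_mem_grid hN hz y
  · intro v
    have hmem : ∀ e : {e : G.edgeSet // v ∈ (e : Sym2 V)},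
        p e.1 ∈ corners N z (s v) (t v) (m v) := fun e => by
      rw [← hcorners]; exact ⟨e.1, e.2, rfl⟩
    exact (affineIndependent_corners hN (hst v) (htN v)).of_injective_of_mem
      (hp.comp Subtype.val_injective) hmem
  · intro u v huv
    have hu : p ⟨s(u, v), G.mem_edgeSet.mpr huv⟩ ∈ corners N z (s u) (t u) (m u) := by
      rw [← hcorners]; exact ⟨_, Sym2.mem_mk_left _ _, rfl⟩
    have hv : p ⟨s(u, v), G.mem_edgeSet.mpr huv⟩ ∈ corners N z (s v) (t v) (m v) := by
      rw [← hcorners]; exact ⟨_, Sym2.mem_mk_right _ _, rfl⟩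
    rw [hcorners, hcorners]
    refine Set.Subset.antisymm (fun x hx => ?_) ?_
    · obtain ⟨h1, h2⟩ := hinter u v huv.ne hx
      exact hone u v huv.ne _ _ h1 h2 hu hv
    · rintro x rfl
      exact ⟨subset_convexHull ℝ _ hu, subset_convexHull ℝ _ hv⟩
  · intro u v huv hnadj
    rw [hcorners, hcorners, Set.eq_empty_iff_forall_notMem]
    intro x hx
    obtain ⟨h1, h2⟩ := hinter u v huv hx
    rw [← hcorners] at h1 h2
    obtain ⟨e, hu, rfl⟩ := h1
    obtain ⟨e', hv, h⟩ := h2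
    obtain rfl := hp h
    have he := (Sym2.mem_and_mem_iff huv).mp ⟨hu, hv⟩
    exact hnadj (by rw [← G.mem_edgeSet, ← he]; exact e.2)
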